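/- arXiv:math/0609832 — 4 statements merged into one kernel-verified Lean document; each statement's English description precedes it below -/
import Mathlib

section
/- Let R be a ring, V a type, and J a linearly ordered type whose strict order is well-founded (a well-ordered index set), with a degree function deg : V → J. Suppose a linear reduction system on V over R has the property that for every rule i, every element of the support of the replacement T i has degree strictly smaller than deg (v i) (i.e., each rule sends a basis element of V to an R-linear combination of basis elements of smaller degree). Then the system is terminal: there is no infinite sequence X₀ → X₁ → X₂ → ⋯ of one-step reductions in the free module V →₀ R. -/
open Finsupp Relation

/-- One-step reduction of a linear reduction system: `X → Y` iff for some rule `i`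
the coefficient `X (v i)` is nonzero and `Y` is obtained from `X` by replacing the
basis element `v i` by `T i`. -/
def Step {R V ι : Type*} [Ring R] (v : ι → V) (T : ι → V →₀ R)
    (X Y : V →₀ R) : Prop :=
  ∃ i, X (v i) ≠ 0 ∧ Y = X - X (v i) • Finsupp.single (v i) 1 + X (v i) • T i

/-- The strict order on coefficients in which `0` lies below every nonzero element
and nothing else is comparable is well-founded. -/
theorem wellFounded_eq_zero_and_ne_zero (R : Type*) [Zero R] :
    WellFounded fun a b : R => a = 0 ∧ b ≠ 0 :=
  ⟨fun _ => ⟨_, fun _ h => ⟨_, fun _ h' => (h'.2 h.1).elim⟩⟩⟩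

/-- A reduction step towards smaller degrees decreases the lexicographic order in which
coordinates of larger degree take precedence and coefficients are compared by vanishing. -/
theorem Step.lex {R V ι J : Type*} [Ring R] [Preorder J]
    {deg : V → J} {v : ι → V} {T : ι → V →₀ R}
    (hdeg : ∀ i, ∀ w ∈ (T i).support, deg w < deg (v i)) {X Y : V →₀ R} (h : Step v T X Y) :
    Finsupp.Lex (fun a b => ¬ deg a < deg b ∧ a ≠ b) (fun a b : R => a = 0 ∧ b ≠ 0) Y X := by
  obtain ⟨i, hX, rfl⟩ := h
  have hT : ∀ w, ¬ deg w < deg (v i) → T i w = 0 := fun w hw =>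
    Finsupp.notMem_support_iff.mp (mt (hdeg i w) hw)
  refine ⟨v i, fun w hw => ?_, ?_, hX⟩
  · simp [hT w hw.1, hw.2.symm]
  · simp [hT (v i) (lt_irrefl _)]

/-- The converse of the one-step reduction relation is well-founded when every rule
lowers the degree. -/
theorem Step.wellFounded_swap {R V ι J : Type*} [Ring R] [Preorder J] [WellFoundedLT J]
    {deg : V → J} {v : ι → V} {T : ι → V →₀ R}
    (hdeg : ∀ i, ∀ w ∈ (T i).support, deg w < deg (v i)) :
    WellFounded (Function.swap (Step v T)) := by
  refine Subrelation.wf (fun h => Step.lex hdeg h) ⟨fun X => ?_⟩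
  refine Finsupp.Lex.acc (fun _ h => h.2 rfl) (wellFounded_eq_zero_and_ne_zero R) X fun a _ => ?_
  refine Subrelation.accessible (r := InvImage (· < ·) deg) ?_
    ((InvImage.wf deg wellFounded_lt).apply a)
  rintro a b ⟨h, hab⟩
  by_contra hlt
  exact h ⟨hlt, hab⟩

/-- If each rule sends a basis element to a linear combination of basis elements of
strictly smaller degree (degrees taken in a well-ordered set `J`), then the linear
reduction system is terminal: there is no infinite chain of one-step reductions. -/
theorem stmt_0 {R V ι J : Type*} [Ring R] [LinearOrder J] [WellFoundedLT J]
    (deg : V → J) (v : ι → V) (T : ι → V →₀ R)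
    (hdeg : ∀ i, ∀ w ∈ (T i).support, deg w < deg (v i)) :
    ¬ ∃ f : ℕ → (V →₀ R), ∀ n, Step v T (f n) (f (n + 1)) := by
  rintro ⟨f, hf⟩
  exact (wellFounded_iff_isEmpty_descending_chain.mp (Step.wellFounded_swap hdeg)).false ⟨f, hf⟩
end

section
/- Let R be a ring, V a type, and J a linearly ordered type whose strict order is well-founded, with a degree function deg : V → J. Suppose a linear reduction system on V over R has the property that for every rule i, every element of the support of T i has degree strictly smaller than deg (v i). If the system is locally confluent on V (whenever single v 1 → Y₁ and single v 1 → Y₂ for some v : V, the elements Y₁ and Y₂ have a common descendant), then it is locally confluent on the free module RV = (V →₀ R): whenever X → Y₁ and X → Y₂ for any X : V →₀ R, the elements Y₁ and Y₂ have a common descendant. -/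
open Finsupp Relation

/-- The `R`-linear operator replacing the basis element `v i` by `T i`. -/
noncomputable def reduceBy {R V ι : Type*} [Ring R] (v : ι → V) (T : ι → V →₀ R) (i : ι) :
    (V →₀ R) →ₗ[R] (V →₀ R) :=
  LinearMap.id +
    (LinearMap.toSpanSingleton R (V →₀ R) (T i - Finsupp.single (v i) 1)).comp
      (Finsupp.lapply (v i))

section reduceBy

variable {R V ι : Type*} [Ring R] {v : ι → V} {T : ι → V →₀ R}

theorem reduceBy_apply (i : ι) (X : V →₀ R) :
    reduceBy v T i X = X + X (v i) • (T i - Finsupp.single (v i) 1) := rfl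

theorem step_iff {X Y : V →₀ R} :
    Step v T X Y ↔ ∃ i, X (v i) ≠ 0 ∧ Y = reduceBy v T i X := by
  simp only [Step, reduceBy_apply, smul_sub, sub_add_eq_add_sub, add_sub_assoc]

theorem reduceBy_of_apply_eq_zero {i : ι} {X : V →₀ R} (h : X (v i) = 0) :
    reduceBy v T i X = X := by
  simp [reduceBy_apply, h]

theorem reduceBy_single (i : ι) : reduceBy v T i (Finsupp.single (v i) 1) = T i := by
  simp [reduceBy_apply]

theorem reduceBy_eq_erase_add (i : ι) (X : V →₀ R) :
    reduceBy v T i X = X.erase (v i) + X (v i) • T i := by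
  have h := Finsupp.erase_add_single (v i) X
  have h' : Finsupp.single (v i) (X (v i)) = X (v i) • Finsupp.single (v i) (1 : R) := by simp
  rw [h'] at h
  nth_rewrite 1 [reduceBy_apply, ← h]
  rw [smul_sub]
  abel

theorem reflTransGen_reduceBy (i : ι) (X : V →₀ R) :
    ReflTransGen (Step v T) X (reduceBy v T i X) := by
  by_cases h : X (v i) = 0
  · rw [reduceBy_of_apply_eq_zero h]
  · exact .single (step_iff.2 ⟨i, h, rfl⟩)

theorem reflTransGen_step_smul (c : R) {X Y : V →₀ R} (h : ReflTransGen (Step v T) X Y) :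
    ReflTransGen (Step v T) (c • X) (c • Y) := by
  induction h with
  | refl => rfl
  | tail _ hs ih =>
    obtain ⟨i, -, rfl⟩ := step_iff.1 hs
    rw [← map_smul]
    exact ih.trans (reflTransGen_reduceBy i _)

theorem reduceBy_reduceBy_self {i : ι} (hi : T i (v i) = 0) (X : V →₀ R) :
    reduceBy v T i (reduceBy v T i X) = reduceBy v T i X := by
  nth_rewrite 2 [reduceBy_apply]
  rw [map_add, map_smul, map_sub, reduceBy_single, reduceBy_of_apply_eq_zero hi]
  simp

/-- If the difference of two elements is a difference made by a single reduction, they have a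
common descendant. -/
theorem join_add_reduceBy {i : ι} (hi : T i (v i) = 0) (W X : V →₀ R) :
    Join (ReflTransGen (Step v T)) (W + X) (W + reduceBy v T i X) := by
  refine ⟨reduceBy v T i (W + X), reflTransGen_reduceBy i _, ?_⟩
  have h := reflTransGen_reduceBy (v := v) (T := T) i (W + reduceBy v T i X)
  rwa [map_add, reduceBy_reduceBy_self hi, ← map_add] at h

/-- Reductions at distinct basis elements are joinable when one of them does not
reintroduce the other basis element. -/
theorem join_reduceBy_of_ne {i j : ι} (hne : v j ≠ v i) (hj : T j (v j) = 0)
    (hji : T j (v i) = 0) (X : V →₀ R) :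
    Join (ReflTransGen (Step v T)) (reduceBy v T i X) (reduceBy v T j X) := by
  refine ⟨reduceBy v T j (reduceBy v T i X), reflTransGen_reduceBy j _,
    (reflTransGen_reduceBy i _).trans ?_⟩
  have h := reflTransGen_reduceBy (v := v) (T := T) j (reduceBy v T i (reduceBy v T j X))
  have hs : (Finsupp.single (v j) (1 : R)) (v i) = 0 := Finsupp.single_eq_of_ne hne.symm
  have key : reduceBy v T i (reduceBy v T j X) =
      reduceBy v T i X + X (v j) • (T j - Finsupp.single (v j) 1) := by
    rw [reduceBy_apply j, map_add, map_smul, map_sub, reduceBy_of_apply_eq_zero hji,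
      reduceBy_of_apply_eq_zero hs]
  have key' : reduceBy v T j (reduceBy v T i (reduceBy v T j X)) =
      reduceBy v T j (reduceBy v T i X) := by
    rw [key, map_add, map_smul, map_sub, reduceBy_single, reduceBy_of_apply_eq_zero hj]
    simp
  rwa [key'] at h

end reduceBy

section degrees

variable {R V ι J : Type*} [Ring R] [LinearOrder J] {deg : V → J}

/-- The multiset of degrees of the basis elements occurring in `X`. -/
def degrees (deg : V → J) (X : V →₀ R) : Multiset J := X.support.val.map deg

/-- Replacing an occurring basis element by terms of smaller degree lowers the multiset of
degrees. -/
theorem degrees_erase_add_lt {X S : V →₀ R} {w : V} (hw : X w ≠ 0)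
    (hS : ∀ u ∈ S.support, deg u < deg w) :
    (degrees deg (X.erase w + S)).IsDershowitzMannaLT (degrees deg X) := by
  classical
  set A := (X.erase w + S).support with hA
  have hSw : S w = 0 := by
    by_contra h
    exact lt_irrefl _ (hS w (Finsupp.mem_support_iff.2 h))
  have hwm : w ∈ X.support \ A := by simp [hA, hw, hSw]
  have split (s t : Finset V) :
      s.val.map deg = (s ∩ t).val.map deg + (s \ t).val.map deg := by
    have hd : Disjoint (s ∩ t) (s \ t) :=
      Finset.disjoint_sdiff.mono_left Finset.inter_subset_right
    rw [← Multiset.map_add, ← Finset.disjUnion_val _ _ hd, Finset.disjUnion_eq_union,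
      Finset.union_comm, Finset.sdiff_union_inter]
  refine ⟨(A ∩ X.support).val.map deg, (A \ X.support).val.map deg,
    (X.support \ A).val.map deg, ?_, split _ _, ?_, ?_⟩
  · intro h
    have := Multiset.mem_map_of_mem deg hwm
    rw [h] at this
    simp at this
  · rw [Finset.inter_comm]
    exact split _ _
  · intro y hy
    obtain ⟨u, hu, rfl⟩ := Multiset.mem_map.1 hy
    refine ⟨deg w, Multiset.mem_map_of_mem deg hwm, hS u ?_⟩
    rw [Finset.mem_val, Finset.mem_sdiff, hA, Finsupp.mem_support_iff,
      Finsupp.notMem_support_iff, Finsupp.add_apply] at hu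
    rw [Finsupp.mem_support_iff]
    by_cases huw : u = w
    · exact absurd (huw ▸ hu.2) hw
    · simpa [Finsupp.erase_ne huw, hu.2] using hu.1

variable {v : ι → V} {T : ι → V →₀ R}

theorem degree_lt_of_reflTransGen (hdeg : ∀ i, ∀ w ∈ (T i).support, deg w < deg (v i))
    {d : J} {X Y : V →₀ R} (h : ReflTransGen (Step v T) X Y)
    (hX : ∀ u ∈ X.support, deg u < d) : ∀ u ∈ Y.support, deg u < d := by
  classical
  induction h with
  | refl => exact hX
  | tail _ hs ih =>
    obtain ⟨i, hi, rfl⟩ := step_iff.1 hs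
    intro u hu
    rw [reduceBy_eq_erase_add] at hu
    rcases Finset.mem_union.1 (Finsupp.support_add hu) with h | h
    · rw [Finsupp.support_erase] at h
      exact ih u (Finset.mem_of_mem_erase h)
    · exact (hdeg i u (Finsupp.support_smul h)).trans (ih _ (Finsupp.mem_support_iff.2 hi))

end degrees

theorem join_trans_of_confluent {α : Type*} {r : α → α → Prop} {a b c : α}
    (hb : ∀ x y, ReflTransGen r b x → ReflTransGen r b y → Join (ReflTransGen r) x y)
    (hab : Join (ReflTransGen r) a b) (hbc : Join (ReflTransGen r) b c) :
    Join (ReflTransGen r) a c := by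
  obtain ⟨x, hax, hbx⟩ := hab
  obtain ⟨y, hby, hcy⟩ := hbc
  obtain ⟨z, hxz, hyz⟩ := hb x y hbx hby
  exact ⟨z, hax.trans hxz, hcy.trans hyz⟩

/-- The inductive step of Newman's lemma. -/
theorem confluent_of_locally_confluent {α : Type*} {r : α → α → Prop} {a : α}
    (ha : ∀ b c, r a b → r a c → Join (ReflTransGen r) b c)
    (ih : ∀ b, r a b → ∀ x y, ReflTransGen r b x → ReflTransGen r b y →
      Join (ReflTransGen r) x y) :
    ∀ x y, ReflTransGen r a x → ReflTransGen r a y → Join (ReflTransGen r) x y := by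
  intro x y hx hy
  rcases hx.cases_head with rfl | ⟨b, hab, hbx⟩
  · exact ⟨y, hy, .refl⟩
  rcases hy.cases_head with rfl | ⟨c, hac, hcy⟩
  · exact ⟨x, .refl, hx⟩
  exact join_trans_of_confluent (ih c hac)
    (join_trans_of_confluent (ih b hab) ⟨x, .refl, hbx⟩ (ha b c hab hac)) ⟨y, hcy, .refl⟩

section confluence

variable {R V ι J : Type*} [Ring R] [LinearOrder J] {deg : V → J} {v : ι → V}
  {T : ι → V →₀ R}

/-- Translates of reductions between terms of degree smaller than `deg w` remain joinable,
provided all elements with smaller multiset of degrees than `X` are confluent. -/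
theorem join_erase_add_of_reflTransGen
    (hdeg : ∀ i, ∀ w ∈ (T i).support, deg w < deg (v i)) {X : V →₀ R} {w : V} (hw : X w ≠ 0)
    (ih : ∀ X', (degrees deg X').IsDershowitzMannaLT (degrees deg X) →
      ∀ Y₁ Y₂, ReflTransGen (Step v T) X' Y₁ → ReflTransGen (Step v T) X' Y₂ →
        Join (ReflTransGen (Step v T)) Y₁ Y₂)
    {A B : V →₀ R} (hA : ∀ u ∈ A.support, deg u < deg w)
    (h : ReflTransGen (Step v T) A B) :
    Join (ReflTransGen (Step v T)) (X.erase w + A) (X.erase w + B) := by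
  induction h with
  | refl => exact ⟨_, .refl, .refl⟩
  | tail hAB hs hj =>
    obtain ⟨i, -, rfl⟩ := step_iff.1 hs
    have hi : T i (v i) = 0 := by
      by_contra h
      exact lt_irrefl _ (hdeg i _ (Finsupp.mem_support_iff.2 h))
    exact join_trans_of_confluent
      (ih _ (degrees_erase_add_lt hw (degree_lt_of_reflTransGen hdeg hAB hA))) hj
      (join_add_reduceBy hi _ _)

theorem join_of_step_of_step (hdeg : ∀ i, ∀ w ∈ (T i).support, deg w < deg (v i))
    (hloc : ∀ (w : V) (Y₁ Y₂ : V →₀ R),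
      Step v T (Finsupp.single w 1) Y₁ → Step v T (Finsupp.single w 1) Y₂ →
      Join (ReflTransGen (Step v T)) Y₁ Y₂) {X : V →₀ R}
    (ih : ∀ X', (degrees deg X').IsDershowitzMannaLT (degrees deg X) →
      ∀ Y₁ Y₂, ReflTransGen (Step v T) X' Y₁ → ReflTransGen (Step v T) X' Y₂ →
        Join (ReflTransGen (Step v T)) Y₁ Y₂)
    {Y₁ Y₂ : V →₀ R} (h₁ : Step v T X Y₁) (h₂ : Step v T X Y₂) :
    Join (ReflTransGen (Step v T)) Y₁ Y₂ := by
  obtain ⟨i, hi, rfl⟩ := step_iff.1 h₁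
  obtain ⟨j, hj, rfl⟩ := step_iff.1 h₂
  have hT (k : ι) (u : V) (h : deg (v k) ≤ deg u) : T k u = 0 := by
    by_contra hne
    exact (hdeg k u (Finsupp.mem_support_iff.2 hne)).not_ge h
  by_cases hij : v i = v j
  · have : Nontrivial R := ⟨_, _, hi⟩
    obtain ⟨Z, hZ₁, hZ₂⟩ := hloc (v i) (T i) (T j)
      (step_iff.2 ⟨i, by simp, (reduceBy_single i).symm⟩)
      (step_iff.2 ⟨j, by simp [hij], by rw [hij, reduceBy_single]⟩)
    have hlow (k : ι) (hk : v k = v i) :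
        ∀ u ∈ (X (v i) • T k).support, deg u < deg (v i) := fun u hu =>
      hk ▸ hdeg k u (Finsupp.support_smul hu)
    have hZ₁' := reflTransGen_step_smul (X (v i)) hZ₁
    have hZ₂' := reflTransGen_step_smul (X (v i)) hZ₂
    rw [reduceBy_eq_erase_add, reduceBy_eq_erase_add, ← hij]
    refine join_trans_of_confluent (ih _ (degrees_erase_add_lt hi
      (degree_lt_of_reflTransGen hdeg hZ₁' (hlow i rfl))))
      (join_erase_add_of_reflTransGen hdeg hi ih (hlow i rfl) hZ₁') ?_
    exact symm (join_erase_add_of_reflTransGen hdeg hi ih (hlow j hij.symm) hZ₂')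
  · rcases le_total (deg (v j)) (deg (v i)) with h | h
    · exact join_reduceBy_of_ne (Ne.symm hij) (hT j _ le_rfl) (hT j _ h) X
    · exact symm (join_reduceBy_of_ne hij (hT i _ le_rfl) (hT i _ h) X)

theorem confluent_of_locally_confluent_on_basis [WellFoundedLT J]
    (hdeg : ∀ i, ∀ w ∈ (T i).support, deg w < deg (v i))
    (hloc : ∀ (w : V) (Y₁ Y₂ : V →₀ R),
      Step v T (Finsupp.single w 1) Y₁ → Step v T (Finsupp.single w 1) Y₂ →
      Join (ReflTransGen (Step v T)) Y₁ Y₂) (X : V →₀ R) :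
    ∀ Y₁ Y₂, ReflTransGen (Step v T) X Y₁ → ReflTransGen (Step v T) X Y₂ →
      Join (ReflTransGen (Step v T)) Y₁ Y₂ := by
  induction X using (InvImage.wf (degrees deg)
    Multiset.wellFounded_isDershowitzMannaLT).induction with
  | _ X ih =>
    refine confluent_of_locally_confluent
      (fun _ _ h₁ h₂ => join_of_step_of_step hdeg hloc ih h₁ h₂) fun Y hY => ih Y ?_
    obtain ⟨i, hi, rfl⟩ := step_iff.1 hY
    rw [reduceBy_eq_erase_add]
    exact degrees_erase_add_lt hi fun u hu => hdeg i u (Finsupp.support_smul hu)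

end confluence

/-- If each rule lowers degree (degrees taken in a well-ordered set `J`) and the
system is locally confluent on `V` (on basis elements), then it is locally
confluent on the free module `RV = (V →₀ R)`. -/
theorem stmt_1 {R V ι J : Type*} [Ring R] [LinearOrder J] [WellFoundedLT J]
    (deg : V → J) (v : ι → V) (T : ι → V →₀ R)
    (hdeg : ∀ i, ∀ w ∈ (T i).support, deg w < deg (v i))
    (hloc : ∀ (w : V) (Y₁ Y₂ : V →₀ R),
      Step v T (Finsupp.single w 1) Y₁ → Step v T (Finsupp.single w 1) Y₂ →
      ∃ Z, ReflTransGen (Step v T) Y₁ Z ∧ ReflTransGen (Step v T) Y₂ Z) :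
    ∀ (X Y₁ Y₂ : V →₀ R), Step v T X Y₁ → Step v T X Y₂ →
      ∃ Z, ReflTransGen (Step v T) Y₁ Z ∧ ReflTransGen (Step v T) Y₂ Z := by
  exact fun X Y₁ Y₂ h₁ h₂ =>
    confluent_of_locally_confluent_on_basis hdeg hloc X Y₁ Y₂ (.single h₁) (.single h₂)
end

section
/- Let M₁ = !![1, 0; 2, 1] and M₂ = !![1, 2; 0, 1] be 2×2 real matrices, and let M be the multiplicative submonoid of 2×2 real matrices generated by {M₁, M₂}. Then there do not exist A, B ∈ M such that (A * M₁).mulVec ![1, Real.sqrt 2] = (B * M₂).mulVec ![1, Real.sqrt 2]. (This says that, for the linear reduction rules S₁ : v₁ → v₁ + 2 v₂ and S₂ : v₂ → v₂ + 2 v₁ on ℝ{v₁, v₂}, the two elements S₁(v₁ + √2 v₂) and S₂(v₁ + √2 v₂) have no common descendant.) -/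
/-- The matrix of the reduction rule `S₁ : v₁ → v₁ + 2 v₂` acting on coefficient
vectors. -/
noncomputable def M1 : Matrix (Fin 2) (Fin 2) ℝ := !![1, 0; 2, 1]

/-- The matrix of the reduction rule `S₂ : v₂ → v₂ + 2 v₁` acting on coefficient
vectors. -/
noncomputable def M2 : Matrix (Fin 2) (Fin 2) ℝ := !![1, 2; 0, 1]

/-- The first row of a product of `M1` and `M2` consists of natural numbers, the first of
which is positive. -/
lemma exists_nat_first_row {A : Matrix (Fin 2) (Fin 2) ℝ}
    (hA : A ∈ Submonoid.closure {M1, M2}) :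
    ∃ a b : ℕ, 0 < a ∧ A 0 0 = a ∧ A 0 1 = b := by
  induction hA using Submonoid.closure_induction_right with
  | one => exact ⟨1, 0, by simp⟩
  | mul_right A _ S hS ih =>
    obtain ⟨a, b, ha, h0, h1⟩ := ih
    rcases hS with rfl | rfl
    · refine ⟨a + b * 2, b, by omega, ?_, ?_⟩ <;>
        simp [M1, Matrix.mul_apply, Fin.sum_univ_two, h0, h1]
    · refine ⟨a, a * 2 + b, ha, ?_, ?_⟩ <;>
        simp [M2, Matrix.mul_apply, Fin.sum_univ_two, h0, h1]

lemma eq_and_eq_of_add_mul_sqrt_two_eq {p q r s : ℤ}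
    (h : (p : ℝ) + q * √2 = r + s * √2) : p = r ∧ q = s := by
  have hqs : q = s := by
    by_contra hne
    have hsub : (q : ℝ) - s ≠ 0 := sub_ne_zero.mpr (by exact_mod_cast hne)
    refine irrational_sqrt_two ⟨((r - p : ℤ) : ℚ) / ((q - s : ℤ) : ℚ), ?_⟩
    push_cast
    rw [div_eq_iff hsub]
    linarith
  subst hqs
  exact ⟨by exact_mod_cast add_right_cancel h, rfl⟩

/-- `S₁(v₁ + √2 v₂)` and `S₂(v₁ + √2 v₂)` have no common descendant: there are no
products `A`, `B` of the matrices `M₁`, `M₂` (including the empty product) with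
`(A * M₁) (1, √2)ᵀ = (B * M₂) (1, √2)ᵀ`. -/
theorem stmt_6 :
    ¬ ∃ A B : Matrix (Fin 2) (Fin 2) ℝ,
      A ∈ Submonoid.closure {M1, M2} ∧ B ∈ Submonoid.closure {M1, M2} ∧
      (A * M1).mulVec ![1, Real.sqrt 2] = (B * M2).mulVec ![1, Real.sqrt 2] := by
  rintro ⟨A, B, hA, hB, h⟩
  obtain ⟨a, b, ha, hA0, hA1⟩ := exists_nat_first_row hA
  obtain ⟨c, d, hc, hB0, hB1⟩ := exists_nat_first_row hB
  have hrow := congrFun h 0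
  simp only [Matrix.mulVec, dotProduct, Matrix.mul_apply, Fin.sum_univ_two, M1, M2, hA0, hA1,
    hB0, hB1, Matrix.of_apply, Matrix.cons_val_zero, Matrix.cons_val_one,
    Matrix.cons_val_fin_one] at hrow
  obtain ⟨h0, h1⟩ := eq_and_eq_of_add_mul_sqrt_two_eq
    (p := a + 2 * b) (q := b) (r := c) (s := 2 * c + d) (by push_cast; linarith)
  omega
end

section
/- Consider the linear reduction system over ℝ on V = Fin 2 with two rules: S₁ replaces the basis element 0 by single 0 1 + single 1 2 (i.e., v₁ → v₁ + 2 v₂), and S₂ replaces the basis element 1 by single 1 1 + single 0 2 (i.e., v₂ → v₂ + 2 v₁). This system is locally confluent on V: whenever single v 1 → Y₁ and single v 1 → Y₂ for v ∈ Fin 2, the elements Y₁ and Y₂ have a common descendant. However, it is not locally confluent on ℝV = (Fin 2 →₀ ℝ): for X = single 0 1 + single 1 (Real.sqrt 2), the two one-step reducts S₁(X) and S₂(X) have no common descendant. -/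
open Finsupp Relation

/-- The replacements of the two rules: `S₁ : v₁ → v₁ + 2 v₂` and
`S₂ : v₂ → v₂ + 2 v₁` on the free ℝ-module over `Fin 2`. -/
noncomputable def T8 : Fin 2 → (Fin 2 →₀ ℝ) :=
  ![Finsupp.single 0 1 + Finsupp.single 1 2,
    Finsupp.single 1 1 + Finsupp.single 0 2]

/-- The element `X = v₁ + √2 v₂`. -/
noncomputable def X8 : Fin 2 →₀ ℝ :=
  Finsupp.single 0 1 + Finsupp.single 1 (Real.sqrt 2)

/-- Coordinatewise description of the one-step reduction of the system `T8`. -/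
lemma step_T8_iff (X Y : Fin 2 →₀ ℝ) :
    Step id T8 X Y ↔ (X 0 ≠ 0 ∧ Y 0 = X 0 ∧ Y 1 = X 1 + 2 * X 0) ∨
      (X 1 ≠ 0 ∧ Y 0 = X 0 + 2 * X 1 ∧ Y 1 = X 1) := by
  simp [Step, T8, Fin.exists_fin_two, Finsupp.ext_iff, Fin.forall_fin_two, mul_comm]

/-- One-step reduction in the system `T8`, starting from an element with positive coefficients. -/
def PosStep (X Y : Fin 2 →₀ ℝ) : Prop :=
  (0 < X 0 ∧ 0 < X 1) ∧ Step id T8 X Y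

lemma PosStep.pos {X Y : Fin 2 →₀ ℝ} (h : PosStep X Y) : 0 < Y 0 ∧ 0 < Y 1 := by
  obtain ⟨⟨h₀, h₁⟩, h⟩ := h
  rcases (step_T8_iff X Y).1 h with ⟨_, e₀, e₁⟩ | ⟨_, e₀, e₁⟩ <;>
    rw [e₀, e₁] <;> constructor <;> linarith

lemma PosStep.sum_lt {X Y : Fin 2 →₀ ℝ} (h : PosStep X Y) : X 0 + X 1 < Y 0 + Y 1 := by
  obtain ⟨⟨h₀, h₁⟩, h⟩ := h
  rcases (step_T8_iff X Y).1 h with ⟨_, e₀, e₁⟩ | ⟨_, e₀, e₁⟩ <;> linarith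

/-- An element has at most one predecessor with positive coefficients. -/
lemma PosStep.left_unique {X X' Y : Fin 2 →₀ ℝ} (h : PosStep X Y) (h' : PosStep X' Y) :
    X = X' := by
  obtain ⟨⟨h₀, h₁⟩, h⟩ := h
  obtain ⟨⟨h₀', h₁'⟩, h'⟩ := h'
  rw [Finsupp.ext_iff, Fin.forall_fin_two]
  rcases (step_T8_iff X Y).1 h with ⟨_, e₀, e₁⟩ | ⟨_, e₀, e₁⟩ <;>
    rcases (step_T8_iff X' Y).1 h' with ⟨_, e₀', e₁'⟩ | ⟨_, e₀', e₁'⟩ <;>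
    constructor <;> linarith

lemma reflTransGen_posStep {X Z : Fin 2 →₀ ℝ} (hX : 0 < X 0 ∧ 0 < X 1)
    (h : ReflTransGen (Step id T8) X Z) : ReflTransGen PosStep X Z := by
  suffices ReflTransGen PosStep X Z ∧ (0 < Z 0 ∧ 0 < Z 1) from this.1
  induction h with
  | refl => exact ⟨.refl, hX⟩
  | tail _ hs ih => exact ⟨ih.1.tail ⟨ih.2, hs⟩, PosStep.pos ⟨ih.2, hs⟩⟩

lemma sum_le_of_reflTransGen {X Z : Fin 2 →₀ ℝ} (h : ReflTransGen PosStep X Z) :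
    X 0 + X 1 ≤ Z 0 + Z 1 := by
  induction h with
  | refl => exact le_rfl
  | tail _ hs ih => exact ih.trans hs.sum_lt.le

/-- Two successors of the same positive element, one of which reduces to the other, agree. -/
lemma eq_of_reflTransGen {X A B : Fin 2 →₀ ℝ} (hA : PosStep X A) (hB : PosStep X B)
    (h : ReflTransGen PosStep A B) : A = B := by
  rcases h.cases_tail with h | ⟨C, hC, hCB⟩
  · exact h.symm
  · obtain rfl := hCB.left_unique hB
    exact absurd (sum_le_of_reflTransGen hC) hA.sum_lt.not_ge

/-- Distinct successors of a positive element have no common descendant. -/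
lemma eq_of_common_descendant {X A B Z : Fin 2 →₀ ℝ} (hA : PosStep X A) (hB : PosStep X B)
    (hAZ : ReflTransGen (Step id T8) A Z) (hBZ : ReflTransGen (Step id T8) B Z) : A = B := by
  have hAZ' := reflTransGen_swap.2 (reflTransGen_posStep hA.pos hAZ)
  have hBZ' := reflTransGen_swap.2 (reflTransGen_posStep hB.pos hBZ)
  have hu : Relator.RightUnique (Function.swap PosStep) :=
    fun _ _ _ h h' => PosStep.left_unique h h'
  rcases ReflTransGen.total_of_right_unique hu hAZ' hBZ' with h | h
  · exact (eq_of_reflTransGen hB hA (reflTransGen_swap.1 h)).symm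
  · exact eq_of_reflTransGen hA hB (reflTransGen_swap.1 h)

/-- The system `S₁ : v₁ → v₁ + 2 v₂`, `S₂ : v₂ → v₂ + 2 v₁` is locally confluent
on `V = Fin 2` (on basis elements), yet not locally confluent on
`ℝV = (Fin 2 →₀ ℝ)`: both rules apply to `X = v₁ + √2 v₂`, but the two one-step
reducts `S₁(X)` and `S₂(X)` have no common descendant. -/
theorem stmt_8 :
    (∀ (w : Fin 2) (Y₁ Y₂ : Fin 2 →₀ ℝ),
      Step id T8 (Finsupp.single w 1) Y₁ → Step id T8 (Finsupp.single w 1) Y₂ →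
      ∃ Z, ReflTransGen (Step id T8) Y₁ Z ∧ ReflTransGen (Step id T8) Y₂ Z) ∧
    Step id T8 X8 (X8 - X8 0 • Finsupp.single 0 1 + X8 0 • T8 0) ∧
    Step id T8 X8 (X8 - X8 1 • Finsupp.single 1 1 + X8 1 • T8 1) ∧
    ¬ ∃ Z : Fin 2 →₀ ℝ,
      ReflTransGen (Step id T8) (X8 - X8 0 • Finsupp.single 0 1 + X8 0 • T8 0) Z ∧
      ReflTransGen (Step id T8) (X8 - X8 1 • Finsupp.single 1 1 + X8 1 • T8 1) Z := by
  have h2 : 0 < Real.sqrt 2 := by positivity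
  have hX₀ : X8 0 = 1 := by simp [X8]
  have hX₁ : X8 1 = Real.sqrt 2 := by simp [X8]
  have hpos : 0 < X8 0 ∧ 0 < X8 1 := by rw [hX₀, hX₁]; exact ⟨one_pos, h2⟩
  have hS₁ : Step id T8 X8 (X8 - X8 0 • Finsupp.single 0 1 + X8 0 • T8 0) :=
    ⟨0, hpos.1.ne', rfl⟩
  have hS₂ : Step id T8 X8 (X8 - X8 1 • Finsupp.single 1 1 + X8 1 • T8 1) :=
    ⟨1, hpos.2.ne', rfl⟩
  refine ⟨?_, hS₁, hS₂, ?_⟩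
  · rintro w Y₁ Y₂ ⟨i, hi, rfl⟩ ⟨j, hj, rfl⟩
    have key : ∀ k : Fin 2, Finsupp.single w (1 : ℝ) (id k) ≠ 0 → k = w := by
      intro k hk
      by_contra hne
      exact hk (Finsupp.single_eq_of_ne hne)
    obtain rfl := key i hi
    obtain rfl := key j hj
    exact ⟨_, .refl, .refl⟩
  · rintro ⟨Z, h₁, h₂⟩
    have h := DFunLike.congr_fun (eq_of_common_descendant ⟨hpos, hS₁⟩ ⟨hpos, hS₂⟩ h₁ h₂) 0
    simp [hX₀, hX₁, T8] at h
end
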